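/- arXiv:2405.05666 — 3 statements merged into one kernel-verified Lean document; each statement's English description precedes it below -/
import Mathlib

section
/- Let (V, {f_{il}}) be a weak lower perfect space over k with a lower perfect basis B. For any b ∈ B, any n ∈ ℤ_{≥0}, and any (i,l) ∈ I^∞, there exists c ∈ k^× such that f_{il}^n(b) − c·𝐟_{il}^n(b) ∈ f_{il}^{d_{il}(b)+n+1} V. -/
open Function

/-- A weak lower perfect space: a `P`-graded `k`-vector space `V = ⊕_{μ ∈ P} V_μ`
with endomorphisms `f il` for `(i,l) ∈ I^∞ = I × ℤ_{>0}`. -/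
structure WeakLowerPerfectSpace (k I P V : Type*) [Field k] [AddCommGroup P]
    [AddCommGroup V] [Module k V] where
  /-- the simple roots `α_i` -/
  alpha : I → P
  alpha_indep : LinearIndependent ℤ alpha
  /-- `P` is a free abelian group -/
  free : Module.Free ℤ P
  /-- the weight spaces `V_μ` -/
  weight : P → Submodule k V
  weight_indep : iSupIndep weight
  weight_sup : ⨆ μ : P, weight μ = ⊤
  /-- the endomorphisms `f_{il}` -/
  f : I × ℕ+ → Module.End k V
  finiteDim : ∀ μ : P, Module.Finite k (weight μ)
  support_bounded : ∃ s : Finset P, ∀ μ : P, weight μ ≠ ⊥ →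
    ∃ lam ∈ s, lam - μ ∈ AddSubmonoid.closure (Set.range alpha)
  f_weight : ∀ (i : I) (l : ℕ+) (μ : P),
    (weight μ).map (f (i, l)) ≤ weight (μ - (l : ℕ) • alpha i)

namespace WeakLowerPerfectSpace

variable {k I P V : Type*} [Field k] [AddCommGroup P] [AddCommGroup V] [Module k V]

/-- `d il v` is the unique `n` with `v ∈ f_{il}^n V \ f_{il}^{n+1} V` (for `v ≠ 0`),
realized as the largest `n` with `v ∈ f_{il}^n V`. -/
noncomputable def d (S : WeakLowerPerfectSpace k I P V) (il : I × ℕ+) (v : V) : ℕ :=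
  sSup {n : ℕ | v ∈ LinearMap.range (S.f il ^ n)}

end WeakLowerPerfectSpace

/-- A lower perfect basis `B` of a weak lower perfect space, with structure maps
`F il : B → B ∪ {0}` (extended by `F il 0 = 0`). -/
structure LowerPerfectBasis {k I P V : Type*} [Field k] [AddCommGroup P]
    [AddCommGroup V] [Module k V] (S : WeakLowerPerfectSpace k I P V) (B : Set V) where
  indep : LinearIndependent k (fun b : B => (b : V))
  spans : Submodule.span k B = ⊤
  graded : ∀ b ∈ B, ∃ μ : P, b ∈ S.weight μ
  /-- the structure map `𝐟_{il}` -/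
  F : I × ℕ+ → V → V
  F_zero : ∀ il : I × ℕ+, F il 0 = 0
  F_mem : ∀ il : I × ℕ+, ∀ b ∈ B, F il b ∈ B ∪ {0}
  F_approx : ∀ il : I × ℕ+, ∀ b ∈ B, ∃ c : kˣ,
    S.f il b - (c : k) • F il b ∈ LinearMap.range (S.f il ^ (S.d il b + 2))
  F_inj : ∀ b ∈ B, ∀ b' ∈ B, (∀ il : I × ℕ+, F il b = F il b') → b = b'

namespace WeakLowerPerfectSpace

variable {k I P V : Type*} [Field k] [AddCommGroup P] [AddCommGroup V] [Module k V]

/-- The subspace `Σ_{(i,l) ∈ I^∞} f_{il} V`. -/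
noncomputable def rad (S : WeakLowerPerfectSpace k I P V) : Submodule k V :=
  ⨆ il : I × ℕ+, LinearMap.range (S.f il)

/-- The highest core `B_H = {b ∈ B | d_{il}(b) = 0 for all (i,l) ∈ I^∞}`. -/
def highestCore (S : WeakLowerPerfectSpace k I P V) (B : Set V) : Set V :=
  {b | b ∈ B ∧ ∀ il : I × ℕ+, S.d il b = 0}

end WeakLowerPerfectSpace

/-- A homogeneous vector in the image of an endomorphism of degree `-δ` is the image of a
homogeneous vector. -/
theorem exists_homogeneous_preimage {k P V : Type*} [Field k] [AddCommGroup P]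
    [AddCommGroup V] [Module k V] {W : P → Submodule k V} (hind : iSupIndep W)
    (hsup : ⨆ μ : P, W μ = ⊤) (g : Module.End k V) (δ : P)
    (hg : ∀ ν : P, (W ν).map g ≤ W (ν - δ)) {μ : P} {v : V} (hv : g v ∈ W μ) :
    ∃ x ∈ W (μ + δ), g x = g v := by
  have htop : W (μ + δ) ⊔ ⨆ (j : P) (_ : j ≠ μ + δ), W j = ⊤ := by
    rw [eq_top_iff, ← hsup]
    refine iSup_le fun ν => ?_
    by_cases h : ν = μ + δ
    · exact h ▸ le_sup_left
    · exact le_sup_of_le_right (le_iSup₂_of_le ν h le_rfl)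
  obtain ⟨x, hx, y, hy, hxy⟩ := Submodule.mem_sup.1 (htop ▸ Submodule.mem_top : v ∈ _)
  have hgx : g x ∈ W μ := by
    simpa using hg (μ + δ) (Submodule.mem_map_of_mem hx)
  have hgy : g y ∈ ⨆ (j : P) (_ : j ≠ μ), W j := by
    have hle : ⨆ (j : P) (_ : j ≠ μ + δ), W j ≤ (⨆ (j : P) (_ : j ≠ μ), W j).comap g := by
      refine iSup₂_le fun ν hν => ?_
      rw [← Submodule.map_le_iff_le_comap]
      exact le_iSup₂_of_le (ν - δ) (fun h => hν (sub_eq_iff_eq_add.1 h)) (hg ν)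
    exact hle hy
  have hsum : g v = g x + g y := by rw [← hxy, map_add]
  have hgy' : g y ∈ W μ := by
    rw [← sub_eq_of_eq_add' hsum]
    exact sub_mem hv hgx
  have hzero : g y = 0 := Submodule.disjoint_def.1 (hind μ) _ hgy' hgy
  exact ⟨x, hx, by rw [hsum, hzero, add_zero]⟩

/-- Subtracting a vector of a linearly independent family too often leaves the cone spanned by
the family. -/
theorem LinearIndependent.exists_bound_sub_nsmul_mem_closure {I P : Type*} [AddCommGroup P]
    {a : I → P} (ha : LinearIndependent ℤ a) (i : I) (x : P) :
    ∃ M : ℕ, ∀ m : ℕ, x - m • a i ∈ AddSubmonoid.closure (Set.range a) → m ≤ M := by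
  have hcone : ∀ y ∈ AddSubmonoid.closure (Set.range a),
      ∃ c : I →₀ ℤ, 0 ≤ c ∧ Finsupp.linearCombination ℤ a c = y := by
    intro y hy
    induction hy using AddSubmonoid.closure_induction with
    | mem y hy =>
      obtain ⟨j, rfl⟩ := hy
      exact ⟨Finsupp.single j 1, Finsupp.single_nonneg.2 zero_le_one, by simp⟩
    | zero => exact ⟨0, le_rfl, by simp⟩
    | add y z _ _ hy hz =>
      obtain ⟨c, hc, rfl⟩ := hy
      obtain ⟨e, he, rfl⟩ := hz
      exact ⟨c + e, add_nonneg hc he, by simp⟩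
  by_cases h : ∃ e : I →₀ ℤ, Finsupp.linearCombination ℤ a e = x
  · obtain ⟨e, rfl⟩ := h
    refine ⟨(e i).natAbs, fun m hm => ?_⟩
    obtain ⟨c, hc, hce⟩ := hcone _ hm
    have heq : c + Finsupp.single i (m : ℤ) = e := by
      apply ha
      simp [hce]
    have hi : c i + m = e i := by
      rw [← heq]
      simp
    have := hc i
    simp only [Finsupp.coe_zero, Pi.zero_apply] at this
    omega
  · refine ⟨0, fun m hm => absurd ?_ h⟩
    obtain ⟨c, -, hce⟩ := hcone _ hm
    exact ⟨c + Finsupp.single i (m : ℤ), by simp [hce]⟩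

theorem Module.End.range_pow_antitone {k V : Type*} [Semiring k] [AddCommMonoid V] [Module k V]
    (g : Module.End k V) : Antitone fun n : ℕ => LinearMap.range (g ^ n) := by
  rintro m n hmn _ ⟨v, rfl⟩
  exact ⟨(g ^ (n - m)) v, by rw [← Module.End.mul_apply, ← pow_add, Nat.add_sub_cancel' hmn]⟩

namespace WeakLowerPerfectSpace

variable {k I P V : Type*} [Field k] [AddCommGroup P] [AddCommGroup V] [Module k V]

theorem map_weight_f_pow_le (S : WeakLowerPerfectSpace k I P V) (i : I) (l : ℕ+) (n : ℕ)
    (μ : P) : (S.weight μ).map (S.f (i, l) ^ n) ≤ S.weight (μ - (n * l : ℕ) • S.alpha i) := by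
  induction n with
  | zero => simp [Module.End.one_eq_id]
  | succ n ih =>
    rw [pow_succ', Module.End.mul_eq_comp, Submodule.map_comp]
    refine (Submodule.map_mono ih).trans ((S.f_weight i l _).trans_eq ?_)
    rw [sub_sub, ← add_nsmul, add_mul, one_mul]

theorem bddAbove_setOf_mem_range_f_pow (S : WeakLowerPerfectSpace k I P V) (il : I × ℕ+)
    {v : V} {μ : P} (hv : v ∈ S.weight μ) (hv0 : v ≠ 0) :
    BddAbove {n : ℕ | v ∈ LinearMap.range (S.f il ^ n)} := by
  obtain ⟨i, l⟩ := il
  obtain ⟨s, hs⟩ := S.support_bounded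
  choose M hM using fun lam : P =>
    S.alpha_indep.exists_bound_sub_nsmul_mem_closure i (lam - μ)
  refine ⟨s.sup M, ?_⟩
  rintro n ⟨w, rfl⟩
  obtain ⟨x, hx, hxw⟩ := exists_homogeneous_preimage S.weight_indep S.weight_sup _ _
    (S.map_weight_f_pow_le i l n) hv
  have hne : S.weight (μ + (n * l : ℕ) • S.alpha i) ≠ ⊥ := by
    intro hbot
    rw [hbot, Submodule.mem_bot] at hx
    exact hv0 (by rw [← hxw, hx, map_zero])
  obtain ⟨lam, hlam, hmem⟩ := hs _ hne
  rw [← sub_sub] at hmem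
  exact (Nat.le_mul_of_pos_right n l.pos).trans
    ((hM lam _ hmem).trans (Finset.le_sup (f := M) hlam))

theorem le_d (S : WeakLowerPerfectSpace k I P V) (il : I × ℕ+) {v : V} {μ : P}
    (hv : v ∈ S.weight μ) (hv0 : v ≠ 0) {n : ℕ} (hn : v ∈ LinearMap.range (S.f il ^ n)) :
    n ≤ S.d il v :=
  le_csSup (S.bddAbove_setOf_mem_range_f_pow il hv hv0) hn

theorem mem_range_f_pow_d (S : WeakLowerPerfectSpace k I P V) (il : I × ℕ+) (v : V) :
    v ∈ LinearMap.range (S.f il ^ S.d il v) := by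
  by_cases h : BddAbove {n : ℕ | v ∈ LinearMap.range (S.f il ^ n)}
  · exact Nat.sSup_mem (s := {n : ℕ | v ∈ LinearMap.range (S.f il ^ n)}) ⟨0, v, by simp⟩ h
  · rw [d, Nat.sSup_of_not_bddAbove h]
    exact ⟨v, by simp⟩

end WeakLowerPerfectSpace

theorem LowerPerfectBasis.iterate_F_mem {k I P V : Type*} [Field k] [AddCommGroup P]
    [AddCommGroup V] [Module k V] {S : WeakLowerPerfectSpace k I P V} {B : Set V}
    (LB : LowerPerfectBasis S B) {b : V} (hb : b ∈ B) (n : ℕ) (il : I × ℕ+) :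
    (LB.F il)^[n] b ∈ B ∪ {0} := by
  induction n with
  | zero => exact Or.inl hb
  | succ n ih =>
    rw [iterate_succ_apply']
    rcases ih with h | h
    · exact LB.F_mem il _ h
    · rw [Set.mem_singleton_iff.1 h, LB.F_zero]
      exact Or.inr rfl

theorem stmt_0 {k I P V : Type*} [Field k] [AddCommGroup P] [AddCommGroup V] [Module k V]
    (S : WeakLowerPerfectSpace k I P V) (B : Set V) (LB : LowerPerfectBasis S B)
    (b : V) (hb : b ∈ B) (n : ℕ) (il : I × ℕ+) :
    ∃ c : kˣ, (S.f il ^ n) b - (c : k) • (LB.F il)^[n] b ∈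
      LinearMap.range (S.f il ^ (S.d il b + n + 1)) := by
  induction n with
  | zero => exact ⟨1, by simp⟩
  | succ n ih =>
    obtain ⟨c, hc⟩ := ih
    rw [iterate_succ_apply']
    have hmem := LB.iterate_F_mem hb n il
    set b' := (LB.F il)^[n] b
    have hstep : (S.f il ^ (n + 1)) b - (c : k) • S.f il b' ∈
        LinearMap.range (S.f il ^ (S.d il b + (n + 1) + 1)) := by
      obtain ⟨w, hw⟩ := hc
      refine ⟨w, ?_⟩
      rw [pow_succ' _ n, ← add_assoc, pow_succ' _ (S.d il b + n + 1), Module.End.mul_apply,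
        Module.End.mul_apply, hw, map_sub, map_smul]
    by_cases h0 : b' = 0
    · refine ⟨1, ?_⟩
      simpa [h0, LB.F_zero] using hstep
    have hb' : b' ∈ B := hmem.resolve_right h0
    have hfb : (S.f il ^ n) b ∈ LinearMap.range (S.f il ^ (S.d il b + n)) := by
      obtain ⟨w, hw⟩ := S.mem_range_f_pow_d il b
      exact ⟨w, by rw [add_comm, pow_add, Module.End.mul_apply, hw]⟩
    have hrange : b' ∈ LinearMap.range (S.f il ^ (S.d il b + n)) := by
      rw [← Submodule.smul_mem_iff _ c.ne_zero]
      have := sub_mem hfb ((S.f il).range_pow_antitone (Nat.le_succ _) hc)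
      rwa [sub_sub_cancel] at this
    obtain ⟨μ, hμ⟩ := LB.graded b' hb'
    have hd := S.le_d il hμ h0 hrange
    obtain ⟨c', hc'⟩ := LB.F_approx il b' hb'
    have hc'' := (S.f il).range_pow_antitone
      (show S.d il b + (n + 1) + 1 ≤ S.d il b' + 2 by omega) hc'
    refine ⟨c * c', ?_⟩
    have := add_mem hstep (Submodule.smul_mem _ (c : k) hc'')
    rwa [smul_sub, sub_add_sub_cancel, smul_smul, ← Units.val_mul] at this
end

section
/- Let (V, {f_{il}}) be a weak lower perfect space over k with a lower perfect basis B. For any n ∈ ℤ_{≥0} and (i,l) ∈ I^∞, the image of the set {b ∈ B : d_{il}(b) = n} under the quotient map f_{il}^n V → f_{il}^n V / f_{il}^{n+1} V is a k-basis of f_{il}^n V / f_{il}^{n+1} V. -/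
open Function

theorem AddSubmonoid.exists_nonneg_linearCombination_of_mem_closure {I P : Type*}
    [AddCommGroup P] {α : I → P} {x : P} (hx : x ∈ AddSubmonoid.closure (Set.range α)) :
    ∃ c : I →₀ ℤ, 0 ≤ c ∧ Finsupp.linearCombination ℤ α c = x := by
  induction hx using AddSubmonoid.closure_induction with
  | mem x hx =>
    obtain ⟨i, rfl⟩ := hx
    exact ⟨Finsupp.single i 1, Finsupp.single_nonneg.2 zero_le_one, by simp⟩
  | zero => exact ⟨0, le_rfl, by simp⟩
  | add x y _ _ hx hy =>
    obtain ⟨c, hc, rfl⟩ := hx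
    obtain ⟨c', hc', rfl⟩ := hy
    exact ⟨c + c', add_nonneg hc hc', by simp⟩

theorem LinearIndependent.exists_forall_sub_nsmul_notMem_closure {I P : Type*} [AddCommGroup P]
    {α : I → P} (hα : LinearIndependent ℤ α) (i : I) (x : P) :
    ∃ N : ℕ, ∀ m, N ≤ m → x - m • α i ∉ AddSubmonoid.closure (Set.range α) := by
  by_contra! h
  obtain ⟨m₁, -, h₁⟩ := h 0
  obtain ⟨c, hc, hcx⟩ := AddSubmonoid.exists_nonneg_linearCombination_of_mem_closure h₁
  obtain ⟨m₂, hm₂, h₂⟩ := h (m₁ + (c i).toNat + 1)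
  obtain ⟨c', hc', hcx'⟩ := AddSubmonoid.exists_nonneg_linearCombination_of_mem_closure h₂
  have key : c' + Finsupp.single i ((m₂ : ℤ) - m₁) = c := by
    apply hα
    rw [map_add, hcx, hcx', Finsupp.linearCombination_single, sub_smul, natCast_zsmul,
      natCast_zsmul]
    abel
  have h₃ := DFunLike.congr_fun key i
  have h₄ : 0 ≤ c' i := hc' i
  simp only [Finsupp.add_apply, Finsupp.single_eq_same] at h₃
  omega

theorem iSupIndep.inf_iSup_le {ι k V : Type*} [Ring k] [AddCommGroup V] [Module k V]
    {A X : ι → Submodule k V} (hA : iSupIndep A) (hX : ∀ i, X i ≤ A i) (i : ι) :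
    A i ⊓ ⨆ j, X j ≤ X i := by
  have h : ⨆ j, X j ≤ X i ⊔ ⨆ (j) (_ : j ≠ i), A j := by
    refine iSup_le fun j => ?_
    by_cases hj : j = i
    · subst hj; exact le_sup_left
    · exact (hX j).trans (le_sup_of_le_right (le_iSup₂_of_le j hj le_rfl))
  calc A i ⊓ ⨆ j, X j ≤ (X i ⊔ ⨆ (j) (_ : j ≠ i), A j) ⊓ A i := by
        rw [inf_comm]; exact inf_le_inf_right _ h
    _ = X i ⊔ (⨆ (j) (_ : j ≠ i), A j) ⊓ A i := sup_inf_assoc_of_le _ (hX i)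
    _ ≤ X i := by rw [(hA i).symm.eq_bot, sup_bot_eq]

namespace WeakLowerPerfectSpace

variable {k I P V : Type*} [Field k] [AddCommGroup P] [AddCommGroup V] [Module k V]
  (S : WeakLowerPerfectSpace k I P V) (il : I × ℕ+)

theorem exists_forall_weight_add_nsmul_eq_bot (μ : P) :
    ∃ N : ℕ, ∀ m, N ≤ m → S.weight (μ + m • (il.2 : ℕ) • S.alpha il.1) = ⊥ := by
  obtain ⟨s, hs⟩ := S.support_bounded
  choose N hN using fun lam : P =>
    S.alpha_indep.exists_forall_sub_nsmul_notMem_closure il.1 (lam - μ)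
  refine ⟨s.sup N, fun m hm => ?_⟩
  by_contra h
  obtain ⟨lam, hlam, hmem⟩ := hs _ h
  refine hN lam (m * il.2) ?_ ?_
  · exact ((Finset.le_sup hlam).trans hm).trans (Nat.le_mul_of_pos_right _ il.2.pos)
  · rwa [mul_smul, sub_sub]

theorem map_pow_weight_le (m : ℕ) (μ : P) :
    (S.weight (μ + m • (il.2 : ℕ) • S.alpha il.1)).map (S.f il ^ m) ≤ S.weight μ := by
  induction m generalizing μ with
  | zero => simp [Module.End.one_eq_id]
  | succ m ih =>
    rw [pow_succ, Module.End.mul_eq_comp, Submodule.map_comp]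
    refine (Submodule.map_mono (S.f_weight il.1 il.2 _)).trans (le_of_eq_of_le ?_ (ih μ))
    congr 2
    rw [succ_nsmul]
    abel

theorem range_pow_eq_iSup (m : ℕ) :
    LinearMap.range (S.f il ^ m) =
      ⨆ μ, (S.weight (μ + m • (il.2 : ℕ) • S.alpha il.1)).map (S.f il ^ m) := by
  rw [← Submodule.map_iSup, LinearMap.range_eq_map, ← S.weight_sup]
  congr 1
  exact ((Equiv.addRight (m • (il.2 : ℕ) • S.alpha il.1)).iSup_comp (g := S.weight)).symm

theorem weight_inf_range_pow_le (m : ℕ) (μ : P) :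
    S.weight μ ⊓ LinearMap.range (S.f il ^ m) ≤
      (S.weight (μ + m • (il.2 : ℕ) • S.alpha il.1)).map (S.f il ^ m) := by
  rw [range_pow_eq_iSup]
  exact S.weight_indep.inf_iSup_le (S.map_pow_weight_le il m) μ

theorem exists_forall_weight_inf_range_pow_eq_bot (μ : P) :
    ∃ N : ℕ, ∀ m, N ≤ m → S.weight μ ⊓ LinearMap.range (S.f il ^ m) = ⊥ := by
  obtain ⟨N, hN⟩ := S.exists_forall_weight_add_nsmul_eq_bot il μ
  refine ⟨N, fun m hm => le_bot_iff.1 ((S.weight_inf_range_pow_le il m μ).trans ?_)⟩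
  rw [hN m hm, Submodule.map_bot]

theorem range_pow_antitone : Antitone fun m => LinearMap.range (S.f il ^ m) := by
  refine antitone_nat_of_succ_le fun m => ?_
  rw [pow_succ, Module.End.mul_eq_comp]
  exact LinearMap.range_comp_le_range _ _

theorem mem_range_pow_of_le_d {v : V} {m : ℕ} (h : m ≤ S.d il v) :
    v ∈ LinearMap.range (S.f il ^ m) := by
  refine S.range_pow_antitone il h ?_
  by_cases hb : BddAbove {n : ℕ | v ∈ LinearMap.range (S.f il ^ n)}
  · exact Nat.sSup_mem ⟨0, by simp [Module.End.one_eq_id]⟩ hb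
  · have : S.d il v = 0 := Nat.sSup_of_not_bddAbove hb
    simp [this, Module.End.one_eq_id]

theorem le_d_of_mem_range_pow {v : V} {μ : P} (hv : v ∈ S.weight μ) (h0 : v ≠ 0) {m : ℕ}
    (h : v ∈ LinearMap.range (S.f il ^ m)) : m ≤ S.d il v := by
  obtain ⟨N, hN⟩ := S.exists_forall_weight_inf_range_pow_eq_bot il μ
  refine le_csSup ⟨N, fun n hn => ?_⟩ h
  by_contra! hlt
  have : v ∈ S.weight μ ⊓ LinearMap.range (S.f il ^ n) := ⟨hv, hn⟩
  rw [hN n hlt.le] at this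
  exact h0 ((Submodule.mem_bot k).1 this)

end WeakLowerPerfectSpace

namespace LowerPerfectBasis

variable {k I P V : Type*} [Field k] [AddCommGroup P] [AddCommGroup V] [Module k V]
  {S : WeakLowerPerfectSpace k I P V} {B : Set V} (il : I × ℕ+)

theorem mem_sup_of_mem_range_pow (LB : LowerPerfectBasis S B) {b : V} (hb : b ∈ B) {n : ℕ}
    (h : b ∈ LinearMap.range (S.f il ^ n)) :
    b ∈ Submodule.span k {b | b ∈ B ∧ S.d il b = n} ⊔ LinearMap.range (S.f il ^ (n + 1)) := by
  obtain ⟨μ, hμ⟩ := LB.graded b hb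
  obtain heq | hlt := (S.le_d_of_mem_range_pow il hμ (LB.indep.ne_zero ⟨b, hb⟩) h).eq_or_lt
  · exact Submodule.mem_sup_left (Submodule.subset_span ⟨hb, heq.symm⟩)
  · exact Submodule.mem_sup_right (S.mem_range_pow_of_le_d il hlt)

theorem range_pow_le_sup (LB : LowerPerfectBasis S B) (n : ℕ) :
    LinearMap.range (S.f il ^ n) ≤
      Submodule.span k {b | b ∈ B ∧ S.d il b = n} ⊔ LinearMap.range (S.f il ^ (n + 1)) := by
  induction n with
  | zero =>
    refine le_top.trans (LB.spans.symm.le.trans (Submodule.span_le.2 fun b hb => ?_))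
    exact LB.mem_sup_of_mem_range_pow il hb (by simp [Module.End.one_eq_id])
  | succ n ih =>
    have h : ∀ m, LinearMap.range (S.f il ^ (m + 1)) =
        (LinearMap.range (S.f il ^ m)).map (S.f il) := fun m => by
      rw [pow_succ', Module.End.mul_eq_comp, LinearMap.range_comp]
    rw [h n]
    refine (Submodule.map_mono ih).trans ?_
    rw [Submodule.map_sup, ← h (n + 1), Submodule.map_span]
    refine sup_le (Submodule.span_le.2 ?_) le_sup_right
    rintro _ ⟨b, ⟨hb, hd⟩, rfl⟩
    obtain ⟨c, hc⟩ := LB.F_approx il b hb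
    rw [hd] at hc
    have hfb : S.f il b ∈ LinearMap.range (S.f il ^ (n + 1)) := by
      rw [h n]
      exact Submodule.mem_map_of_mem (S.mem_range_pow_of_le_d il hd.ge)
    have hcF : (c : k) • LB.F il b ∈ LinearMap.range (S.f il ^ (n + 1)) := by
      have := Submodule.sub_mem _ hfb (S.range_pow_antitone il (Nat.le_succ (n + 1)) hc)
      simpa using this
    have hF : LB.F il b ∈ LinearMap.range (S.f il ^ (n + 1)) :=
      (Submodule.smul_mem_iff _ c.ne_zero).1 hcF
    rw [SetLike.mem_coe, ← sub_add_cancel (S.f il b) ((c : k) • LB.F il b)]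
    refine Submodule.add_mem _ (Submodule.mem_sup_right hc) (Submodule.smul_mem _ _ ?_)
    obtain hB | h0 := LB.F_mem il b hb
    · exact LB.mem_sup_of_mem_range_pow il hB hF
    · rw [Set.mem_singleton_iff.1 h0]
      exact Submodule.zero_mem _

theorem weight_inf_range_pow_le_sup (LB : LowerPerfectBasis S B) (n : ℕ) (μ : P) :
    S.weight μ ⊓ LinearMap.range (S.f il ^ n) ≤
      Submodule.span k {b | b ∈ B ∧ S.d il b = n} ⊔
        S.weight μ ⊓ LinearMap.range (S.f il ^ (n + 1)) := by
  let X : P → Submodule k V := fun ν =>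
    Submodule.span k {b | (b ∈ B ∧ S.d il b = n) ∧ b ∈ S.weight ν} ⊔
      S.weight ν ⊓ LinearMap.range (S.f il ^ (n + 1))
  have hX : ∀ ν, X ν ≤ S.weight ν := fun ν =>
    sup_le (Submodule.span_le.2 fun b hb => hb.2) inf_le_left
  have hsup : LinearMap.range (S.f il ^ n) ≤ ⨆ ν, X ν := by
    refine (LB.range_pow_le_sup il n).trans (sup_le (Submodule.span_le.2 fun b hb => ?_) ?_)
    · obtain ⟨ν, hν⟩ := LB.graded b hb.1
      exact Submodule.mem_iSup_of_mem ν
        (Submodule.mem_sup_left (Submodule.subset_span ⟨hb, hν⟩))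
    · rw [S.range_pow_eq_iSup]
      exact iSup_mono fun ν => le_sup_of_le_right
        (le_inf (S.map_pow_weight_le il _ ν) LinearMap.map_le_range)
  refine (inf_le_inf_left _ hsup).trans ((S.weight_indep.inf_iSup_le hX μ).trans ?_)
  exact sup_le_sup_right (Submodule.span_mono fun b hb => hb.1) _

theorem range_pow_le_span (LB : LowerPerfectBasis S B) (n : ℕ) :
    LinearMap.range (S.f il ^ n) ≤ Submodule.span k {b | b ∈ B ∧ n ≤ S.d il b} := by
  have key (μ : P) : S.weight μ ⊓ LinearMap.range (S.f il ^ n) ≤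
      Submodule.span k {b | b ∈ B ∧ n ≤ S.d il b} := by
    obtain ⟨N, hN⟩ := S.exists_forall_weight_inf_range_pow_eq_bot il μ
    have step (j : ℕ) : S.weight μ ⊓ LinearMap.range (S.f il ^ n) ≤
        Submodule.span k {b | b ∈ B ∧ n ≤ S.d il b} ⊔
          S.weight μ ⊓ LinearMap.range (S.f il ^ (n + j)) := by
      induction j with
      | zero => exact le_sup_right
      | succ j ih =>
        refine ih.trans (sup_le le_sup_left
          ((LB.weight_inf_range_pow_le_sup il (n + j) μ).trans (sup_le_sup_right ?_ _)))
        exact Submodule.span_mono fun b hb => ⟨hb.1, by rw [hb.2]; exact Nat.le_add_right _ _⟩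
    have := step N
    rwa [hN _ (Nat.le_add_left _ _), sup_bot_eq] at this
  conv_lhs => rw [S.range_pow_eq_iSup]
  exact iSup_le fun μ =>
    (le_inf (S.map_pow_weight_le il _ μ) LinearMap.map_le_range).trans (key μ)

end LowerPerfectBasis

theorem stmt_4 {k I P V : Type*} [Field k] [AddCommGroup P] [AddCommGroup V] [Module k V]
    (S : WeakLowerPerfectSpace k I P V) (B : Set V) (LB : LowerPerfectBasis S B)
    (il : I × ℕ+) (n : ℕ) :
    LinearIndependent k
      (fun x : ↥(⇑(LinearMap.range (S.f il ^ (n + 1))).mkQ '' {b | b ∈ B ∧ S.d il b = n}) =>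
        (x : V ⧸ LinearMap.range (S.f il ^ (n + 1)))) ∧
    Submodule.span k
        (⇑(LinearMap.range (S.f il ^ (n + 1))).mkQ '' {b | b ∈ B ∧ S.d il b = n}) =
      Submodule.map (LinearMap.range (S.f il ^ (n + 1))).mkQ
        (LinearMap.range (S.f il ^ n)) := by
  have hsub : {b | b ∈ B ∧ S.d il b = n} ⊆ B := fun b hb => hb.1
  have hdisj : Disjoint (Submodule.span k {b | b ∈ B ∧ S.d il b = n})
      (LinearMap.range (S.f il ^ (n + 1))) := by
    refine Disjoint.mono_right (LB.range_pow_le_span il (n + 1)) ?_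
    have hd : Disjoint {b : B | S.d il b = n} {b : B | n + 1 ≤ S.d il b} := by
      refine Set.disjoint_left.2 fun b h₁ h₂ => ?_
      simp only [Set.mem_ofPred_eq] at h₁ h₂
      omega
    convert LB.indep.disjoint_span_image hd using 2 <;>
    · ext b
      simp
      tauto
  constructor
  · have hD : LinearIndependent k (fun b : ↥{b | b ∈ B ∧ S.d il b = n} => (b : V)) :=
      LinearIndepOn.mono (v := id) LB.indep hsub
    have hQ := hD.map (f := (LinearMap.range (S.f il ^ (n + 1))).mkQ)
      (by simpa using hdisj)
    have := hQ.linearIndepOn_id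
    rw [Set.range_comp, Subtype.range_coe] at this
    exact this
  · rw [← Submodule.map_span]
    refine le_antisymm (Submodule.map_mono (Submodule.span_le.2 fun b hb =>
      S.mem_range_pow_of_le_d il hb.2.ge)) ?_
    refine (Submodule.map_mono (LB.range_pow_le_sup il n)).trans ?_
    rw [Submodule.map_sup, Submodule.mkQ_map_self, sup_bot_eq]
end

section
/- Let (V, {f_{il}}) be a weak lower perfect space over k with a lower perfect basis B, and let i = ((i_k,l_k))_{k≥1} be a good index sequence. Then for every b ∈ B, the sequence d(i,b) = (d_k)_{k≥1} is good (i.e. d_k = 0 for all sufficiently large k), and b_k ∈ B_H for all sufficiently large k. -/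
open Function

/-- Iterated application `𝐟_{i_1 l_1}^{a_1} ⋯ 𝐟_{i_r l_r}^{a_r}(b)` (rightmost factor applied
first): `fComp F seq a r b = F_{seq 0}^{a 0} (⋯ (F_{seq (r-1)}^{a (r-1)} b))`. -/
def fComp {V ι : Type*} (F : ι → V → V) (seq : ℕ → ι) (a : ℕ → ℕ) : ℕ → V → V
  | 0, v => v
  | m + 1, v => fComp F seq a m ((F (seq m))^[a m] v)

/-- Iterated application `𝐞_{i_r l_r}^{a_r} ⋯ 𝐞_{i_1 l_1}^{a_1}(b)` (leftmost index applied
first): `eComp E seq a r b = E_{seq (r-1)}^{a (r-1)} (⋯ (E_{seq 0}^{a 0} b))`. -/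
def eComp {V ι : Type*} (E : ι → V → V) (seq : ℕ → ι) (a : ℕ → ℕ) : ℕ → V → V
  | 0, v => v
  | m + 1, v => (E (seq m))^[a m] (eComp E seq a m v)

/-- The sequence `b_0 = b`, `b_{k+1} = 𝐞_{i_{k+1} l_{k+1}}^{d_{i_{k+1} l_{k+1}}(b_k)}(b_k)`. -/
def bseq {V ι : Type*} (E : ι → V → V) (d : ι → V → ℕ) (seq : ℕ → ι) (b : V) : ℕ → V
  | 0 => b
  | m + 1 => (E (seq m))^[d (seq m) (bseq E d seq b m)] (bseq E d seq b m)

/-- The lexicographic strict order on sequences of non-negative integers. -/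
def SeqLt (a a' : ℕ → ℕ) : Prop :=
  ∃ m : ℕ, (∀ s < m, a s = a' s) ∧ a m < a' m

/-- The lexicographic order on sequences of non-negative integers. -/
def SeqLe (a a' : ℕ → ℕ) : Prop := a = a' ∨ SeqLt a a'

namespace WeakLowerPerfectSpace

variable {k I P V : Type*} [Field k] [AddCommGroup P] [AddCommGroup V] [Module k V]

/-- The composite `f_{i_1 l_1}^{a_1} ⋯ f_{i_m l_m}^{a_m}` (as an endomorphism, the
rightmost factor acting first). -/
noncomputable def pprod (S : WeakLowerPerfectSpace k I P V) (seq : ℕ → I × ℕ+)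
    (a : ℕ → ℕ) (m : ℕ) : Module.End k V :=
  ((List.range m).map fun j => S.f (seq j) ^ a j).prod

/-- The subspace `V^{>i,a} = Σ_{k=1}^r f_{i_1l_1}^{a_1}⋯f_{i_{k−1}l_{k−1}}^{a_{k−1}} f_{i_kl_k}^{a_k+1} V`. -/
noncomputable def Vgt (S : WeakLowerPerfectSpace k I P V) (seq : ℕ → I × ℕ+)
    (a : ℕ → ℕ) (r : ℕ) : Submodule k V :=
  ⨆ m : Fin r, LinearMap.range (S.pprod seq a (m : ℕ) * S.f (seq (m : ℕ)) ^ (a (m : ℕ) + 1))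

/-- The subspace `V^{≥i,a} = V^{>i,a} + f_{i_1l_1}^{a_1}⋯f_{i_rl_r}^{a_r} V`. -/
noncomputable def Vge (S : WeakLowerPerfectSpace k I P V) (seq : ℕ → I × ℕ+)
    (a : ℕ → ℕ) (r : ℕ) : Submodule k V :=
  S.Vgt seq a r ⊔ LinearMap.range (S.pprod seq a r)

end WeakLowerPerfectSpace

namespace WeakLowerPerfectSpace

variable {k I P V : Type*} [Field k] [AddCommGroup P] [AddCommGroup V] [Module k V]

/-- Only finitely many heights occur among the weights lying above a given element of `P`. -/
lemma exists_degree_bound (S : WeakLowerPerfectSpace k I P V) (μ : P) :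
    ∃ N : ℕ, ∀ c : I →₀ ℕ,
      S.weight (μ + Finsupp.linearCombination ℕ S.alpha c) ≠ ⊥ → c.degree ≤ N := by
  obtain ⟨s, hs⟩ := S.support_bounded
  have hind : Injective (Finsupp.linearCombination ℕ S.alpha) :=
    S.alpha_indep.restrict_scalars (R := ℕ) (by
      intro a b hab
      simpa using hab)
  have hmem : ∀ x ∈ AddSubmonoid.closure (Set.range S.alpha),
      ∃ e : I →₀ ℕ, Finsupp.linearCombination ℕ S.alpha e = x := by
    intro x hx
    rw [← Submodule.span_nat_eq_addSubmonoidClosure, Submodule.mem_toAddSubmonoid] at hx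
    rwa [← LinearMap.mem_range, Finsupp.range_linearCombination]
  have key : ∀ lam : P, ∃ N : ℕ, ∀ c : I →₀ ℕ,
      lam - (μ + Finsupp.linearCombination ℕ S.alpha c) ∈
        AddSubmonoid.closure (Set.range S.alpha) → c.degree ≤ N := by
    intro lam
    by_cases h : ∃ c : I →₀ ℕ, lam - (μ + Finsupp.linearCombination ℕ S.alpha c) ∈
        AddSubmonoid.closure (Set.range S.alpha)
    · obtain ⟨c₀, h₀⟩ := h
      obtain ⟨e₀, he₀⟩ := hmem _ h₀
      refine ⟨(c₀ + e₀).degree, fun c hc => ?_⟩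
      obtain ⟨e, he⟩ := hmem _ hc
      have : c + e = c₀ + e₀ := by
        apply hind
        rw [map_add, map_add, he, he₀]
        abel
      rw [← this, map_add]
      exact Nat.le_add_right _ _
    · exact ⟨0, fun c hc => (h ⟨c, hc⟩).elim⟩
  choose N hN using key
  refine ⟨s.sup N, fun c hc => ?_⟩
  obtain ⟨lam, hlam, h⟩ := hs _ hc
  exact (hN lam c h).trans (Finset.le_sup hlam)

/-- The projections onto the weight spaces. -/
lemma exists_projections (S : WeakLowerPerfectSpace k I P V) :
    ∃ p : P → V →ₗ[k] V, (∀ μ v, p μ v ∈ S.weight μ) ∧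
      (∀ μ, ∀ v ∈ S.weight μ, p μ v = v) ∧
      (∀ μ ν, ν ≠ μ → ∀ v ∈ S.weight ν, p μ v = 0) ∧
      ∀ v, (∀ μ, p μ v = 0) → v = 0 := by
  classical
  let := (DirectSum.isInternal_submodule_of_iSupIndep_of_iSup_eq_top
    S.weight_indep S.weight_sup).chooseDecomposition
  refine ⟨fun μ => (S.weight μ).subtype ∘ₗ DirectSum.component k P (fun ν => S.weight ν) μ ∘ₗ
    (DirectSum.decomposeLinearEquiv S.weight).toLinearMap, fun μ v => ?_, fun μ v hv => ?_,
    fun μ ν hne v hv => ?_, fun v hv => ?_⟩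
  · exact Submodule.coe_mem _
  · exact DirectSum.decompose_of_mem_same S.weight hv
  · exact DirectSum.decompose_of_mem_ne S.weight hv hne
  · apply (DirectSum.decomposeLinearEquiv S.weight).injective
    rw [map_zero]
    ext μ
    exact hv μ

lemma f_pow_mem (S : WeakLowerPerfectSpace k I P V) (il : I × ℕ+) (n : ℕ) :
    ∀ {μ : P} {v : V}, v ∈ S.weight μ →
      (S.f il ^ n) v ∈ S.weight (μ - (n * (il.2 : ℕ)) • S.alpha il.1) := by
  induction n with
  | zero => intro μ v hv; simpa using hv
  | succ n ih =>
    intro μ v hv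
    have := ih (S.f_weight il.1 il.2 μ (Submodule.mem_map_of_mem hv))
    rw [pow_succ, Module.End.mul_apply, add_mul, one_mul, add_smul, add_comm, ← sub_sub]
    exact this

lemma range_pow_anti (S : WeakLowerPerfectSpace k I P V) (il : I × ℕ+) :
    Antitone fun n : ℕ => LinearMap.range (S.f il ^ n) := by
  intro m n hmn
  obtain ⟨r, rfl⟩ := Nat.exists_eq_add_of_le hmn
  rintro _ ⟨w, rfl⟩
  exact ⟨(S.f il ^ r) w, by rw [pow_add, Module.End.mul_apply]⟩

/-- A system of projections onto the weight spaces intertwines the powers of `f_{il}`. -/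
lemma proj_f_pow (S : WeakLowerPerfectSpace k I P V) {p : P → V →ₗ[k] V}
    (hp : ∀ μ, ∀ v ∈ S.weight μ, p μ v = v)
    (hp' : ∀ μ ν, ν ≠ μ → ∀ v ∈ S.weight ν, p μ v = 0)
    (il : I × ℕ+) (n : ℕ) (μ : P) (v : V) :
    p μ ((S.f il ^ n) v) = (S.f il ^ n) (p (μ + (n * (il.2 : ℕ)) • S.alpha il.1) v) := by
  have hv : v ∈ ⨆ ν, S.weight ν := by rw [S.weight_sup]; trivial
  induction hv using Submodule.iSup_induction' with
  | mem ν v hv =>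
    have h := S.f_pow_mem il n hv
    by_cases hν : ν = μ + (n * (il.2 : ℕ)) • S.alpha il.1
    · rw [← hν, hp ν v hv]
      apply hp
      rwa [hν, add_sub_cancel_right] at h
    · rw [hp' _ ν hν v hv, map_zero]
      refine hp' _ _ (fun h' => hν ?_) _ h
      rw [← h', sub_add_cancel]
  | zero => simp
  | add x y _ _ hx hy => simp only [map_add, hx, hy]

lemma exists_proj_pow_eq_zero (S : WeakLowerPerfectSpace k I P V) {p : P → V →ₗ[k] V}
    (hmem : ∀ μ v, p μ v ∈ S.weight μ)
    (hp : ∀ μ, ∀ v ∈ S.weight μ, p μ v = v)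
    (hp' : ∀ μ ν, ν ≠ μ → ∀ v ∈ S.weight ν, p μ v = 0)
    (il : I × ℕ+) (μ : P) :
    ∃ N : ℕ, ∀ n ≥ N, ∀ v ∈ LinearMap.range (S.f il ^ n), p μ v = 0 := by
  obtain ⟨N, hN⟩ := S.exists_degree_bound μ
  refine ⟨N + 1, fun n hn => ?_⟩
  rintro _ ⟨w, rfl⟩
  rw [S.proj_f_pow hp hp']
  have hbot : S.weight (μ + (n * (il.2 : ℕ)) • S.alpha il.1) = ⊥ := by
    by_contra h
    have := hN (Finsupp.single il.1 (n * (il.2 : ℕ))) (by rwa [Finsupp.linearCombination_single])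
    rw [Finsupp.degree_single] at this
    have := il.2.pos
    nlinarith
  have h := hmem (μ + (n * (il.2 : ℕ)) • S.alpha il.1) w
  rw [hbot, Submodule.mem_bot] at h
  rw [h, map_zero]

lemma mem_range_pow_iff (S : WeakLowerPerfectSpace k I P V) (il : I × ℕ+) {v : V} (hv : v ≠ 0)
    (n : ℕ) : v ∈ LinearMap.range (S.f il ^ n) ↔ n ≤ S.d il v := by
  obtain ⟨p, hmem, hp, hp', hsep⟩ := S.exists_projections
  have : ∃ μ, p μ v ≠ 0 := by
    by_contra! h
    exact hv (hsep v h)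
  obtain ⟨μ, hμ⟩ := this
  obtain ⟨N, hN⟩ := S.exists_proj_pow_eq_zero hmem hp hp' il μ
  have hbdd : BddAbove {n : ℕ | v ∈ LinearMap.range (S.f il ^ n)} :=
    ⟨N, fun n hn => by
      by_contra! h
      exact hμ (hN n h.le v hn)⟩
  have hne : {n : ℕ | v ∈ LinearMap.range (S.f il ^ n)}.Nonempty := ⟨0, v, by simp⟩
  exact ⟨fun h => le_csSup hbdd h, fun h => S.range_pow_anti il h (Nat.sSup_mem hne hbdd)⟩

end WeakLowerPerfectSpace

namespace LowerPerfectBasis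

variable {k I P V : Type*} [Field k] [AddCommGroup P] [AddCommGroup V] [Module k V]
  {S : WeakLowerPerfectSpace k I P V} {B : Set V}

lemma ne_zero (LB : LowerPerfectBasis S B) {b : V} (hb : b ∈ B) : b ≠ 0 :=
  LB.indep.ne_zero ⟨b, hb⟩

lemma F_mem_range (LB : LowerPerfectBasis S B) (il : I × ℕ+) {b : V} (hb : b ∈ B) :
    LB.F il b ∈ LinearMap.range (S.f il ^ (S.d il b + 1)) := by
  obtain ⟨c, hc⟩ := LB.F_approx il b hb
  have h₁ : S.f il b ∈ LinearMap.range (S.f il ^ (S.d il b + 1)) := by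
    obtain ⟨w, hw⟩ := (S.mem_range_pow_iff il (LB.ne_zero hb) _).2 le_rfl
    exact ⟨w, by rw [pow_succ', Module.End.mul_apply, hw]⟩
  have h₂ := Submodule.sub_mem _ h₁ (S.range_pow_anti il (Nat.le_succ _) hc)
  rw [sub_sub_cancel] at h₂
  exact (Submodule.smul_mem_iff _ c.ne_zero).1 h₂

/-- The subspace `f_{il}^{n+1} V` is spanned by the images `𝐟_{il} b` of the basis elements
`b ∈ f_{il}^n V`. -/
lemma range_pow_succ_le_span (LB : LowerPerfectBasis S B) (il : I × ℕ+) (n : ℕ) :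
    LinearMap.range (S.f il ^ (n + 1)) ≤
      Submodule.span k (LB.F il '' {b ∈ B | n ≤ S.d il b}) := by
  obtain ⟨p, hmem, hp, hp', hsep⟩ := S.exists_projections
  have hpB : ∀ b ∈ B, ∀ μ, p μ b = b ∨ p μ b = 0 := by
    intro b hb μ
    obtain ⟨ν, hν⟩ := LB.graded b hb
    by_cases h : ν = μ
    · subst h; exact Or.inl (hp _ _ hν)
    · exact Or.inr (hp' _ _ h _ hν)
  have hstep : ∀ m, Submodule.map (S.f il) (Submodule.span k {b ∈ B | m ≤ S.d il b}) ≤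
      Submodule.span k (LB.F il '' {b ∈ B | m ≤ S.d il b}) ⊔
        LinearMap.range (S.f il ^ (m + 2)) := by
    intro m
    rw [Submodule.map_span, Submodule.span_le]
    rintro _ ⟨b, ⟨hb, hm⟩, rfl⟩
    obtain ⟨c, hc⟩ := LB.F_approx il b hb
    rw [← add_sub_cancel ((c : k) • LB.F il b) (S.f il b)]
    exact Submodule.add_mem_sup (Submodule.smul_mem _ _ (Submodule.subset_span ⟨b, ⟨hb, hm⟩, rfl⟩))
      (S.range_pow_anti il (by omega) hc)
  have hFspan : ∀ m, Submodule.span k (LB.F il '' {b ∈ B | m ≤ S.d il b}) ≤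
      Submodule.span k {b ∈ B | m + 1 ≤ S.d il b} := by
    intro m
    rw [Submodule.span_le]
    rintro _ ⟨b, ⟨hb, hm⟩, rfl⟩
    rcases LB.F_mem il b hb with h | h
    · refine Submodule.subset_span ⟨h, ?_⟩
      exact (Nat.succ_le_succ hm).trans
        ((S.mem_range_pow_iff il (LB.ne_zero h) _).1 (LB.F_mem_range il hb))
    · rw [Set.mem_singleton_iff.1 h]; exact Submodule.zero_mem _
  have hmap : ∀ m, LinearMap.range (S.f il ^ (m + 1)) =
      Submodule.map (S.f il) (LinearMap.range (S.f il ^ m)) := by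
    intro m
    rw [pow_succ', Module.End.mul_eq_comp, LinearMap.range_comp]
  have happrox : ∀ m, LinearMap.range (S.f il ^ (m + 1)) ≤
      Submodule.span k (LB.F il '' {b ∈ B | m ≤ S.d il b}) ⊔
        LinearMap.range (S.f il ^ (m + 2)) := by
    intro m
    induction m with
    | zero =>
      refine le_trans ?_ (hstep 0)
      rw [hmap]
      refine Submodule.map_mono ?_
      simp [LB.spans]
    | succ m ih =>
      rw [hmap]
      refine (Submodule.map_mono ih).trans ?_
      rw [Submodule.map_sup, ← hmap]
      exact sup_le ((Submodule.map_mono (hFspan m)).trans (hstep (m + 1))) le_sup_right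
  have hall : ∀ r, LinearMap.range (S.f il ^ (n + 1)) ≤
      Submodule.span k (LB.F il '' {b ∈ B | n ≤ S.d il b}) ⊔
        LinearMap.range (S.f il ^ (n + 1 + r)) := by
    intro r
    induction r with
    | zero => exact le_sup_right
    | succ r ih =>
      refine ih.trans (sup_le le_sup_left ?_)
      have := happrox (n + r)
      rw [show n + 1 + r = n + r + 1 by omega, show n + 1 + (r + 1) = n + r + 2 by omega]
      refine this.trans (sup_le_sup_right (Submodule.span_mono (Set.image_mono ?_)) _)
      exact fun b hb => ⟨hb.1, (Nat.le_add_right n r).trans hb.2⟩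
  have hpspan : ∀ μ, ∀ v ∈ Submodule.span k (LB.F il '' {b ∈ B | n ≤ S.d il b}),
      p μ v ∈ Submodule.span k (LB.F il '' {b ∈ B | n ≤ S.d il b}) := by
    intro μ v hv
    suffices h : Submodule.span k (LB.F il '' {b ∈ B | n ≤ S.d il b}) ≤
        (Submodule.span k (LB.F il '' {b ∈ B | n ≤ S.d il b})).comap (p μ) from h hv
    rw [Submodule.span_le]
    rintro _ ⟨b, hb, rfl⟩
    rw [SetLike.mem_coe, Submodule.mem_comap]
    have hspan := Submodule.subset_span (R := k) (Set.mem_image_of_mem (LB.F il) hb)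
    rcases LB.F_mem il b hb.1 with h | h
    · rcases hpB _ h μ with h' | h' <;> rw [h']
      · exact hspan
      · exact Submodule.zero_mem _
    · rw [Set.mem_singleton_iff.1 h, map_zero]; exact Submodule.zero_mem _
  have hhom : ∀ μ, ∀ v ∈ S.weight μ, (S.f il ^ (n + 1)) v ∈
      Submodule.span k (LB.F il '' {b ∈ B | n ≤ S.d il b}) := by
    intro μ v hv
    have hw := S.f_pow_mem il (n + 1) hv
    obtain ⟨N, hN⟩ := S.exists_proj_pow_eq_zero hmem hp hp' il
      (μ - ((n + 1) * (il.2 : ℕ)) • S.alpha il.1)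
    obtain ⟨u, hu, w, hwr, huw⟩ := Submodule.mem_sup.1 (hall N ⟨v, rfl⟩)
    rw [← hp _ _ hw, ← huw, map_add, hN _ (by omega) w hwr, add_zero]
    exact hpspan _ u hu
  rw [LinearMap.range_eq_map, ← S.weight_sup, Submodule.map_iSup]
  refine iSup_le fun μ => ?_
  rintro _ ⟨v, hv, rfl⟩
  exact hhom μ v hv

/-- Every basis element with `d_{il} > 0` is of the form `𝐟_{il} b'`. -/
lemma exists_F_eq (LB : LowerPerfectBasis S B) (il : I × ℕ+) {b : V} (hb : b ∈ B) {n : ℕ}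
    (hn : S.d il b = n + 1) : ∃ b' ∈ B, LB.F il b' = b ∧ S.d il b' = n := by
  have h₁ := LB.range_pow_succ_le_span il n ((S.mem_range_pow_iff il (LB.ne_zero hb) _).2 hn.ge)
  have h₂ : b ∈ LB.F il '' {b ∈ B | n ≤ S.d il b} := by
    by_contra hnot
    have hsub : LB.F il '' {b ∈ B | n ≤ S.d il b} ⊆ (B \ {b}) ∪ {0} := by
      intro x hx
      obtain ⟨y, hy, rfl⟩ := id hx
      rcases LB.F_mem il y hy.1 with h | h
      · exact Or.inl ⟨h, fun h' => hnot (Set.mem_singleton_iff.1 h' ▸ hx)⟩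
      · exact Or.inr h
    have h₃ := Submodule.span_mono hsub h₁
    rw [Set.union_singleton, Submodule.span_insert_zero] at h₃
    have hind : LinearIndepOn k id B := LB.indep
    rw [← Set.insert_sdiff_self_of_mem hb] at hind
    exact hind.notMem_span_of_insert (by simp) (by rwa [Set.image_id])
  obtain ⟨b', ⟨hb', hle⟩, hF⟩ := h₂
  refine ⟨b', hb', hF, le_antisymm ?_ hle⟩
  have h := LB.F_mem_range il hb'
  rw [hF, S.mem_range_pow_iff il (LB.ne_zero hb), hn] at h
  omega

lemma weight_of_F_eq (LB : LowerPerfectBasis S B) (il : I × ℕ+) {b b' : V} {μ : P}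
    (hb : b ∈ B) (hb' : b' ∈ B) (hF : LB.F il b' = b) (hd : S.d il b = S.d il b' + 1)
    (hμ : b ∈ S.weight μ) : b' ∈ S.weight (μ + (il.2 : ℕ) • S.alpha il.1) := by
  obtain ⟨p, hmem, hp, hp', hsep⟩ := S.exists_projections
  obtain ⟨ν, hν⟩ := LB.graded b' hb'
  by_cases h : ν = μ + (il.2 : ℕ) • S.alpha il.1
  · rwa [← h]
  exfalso
  obtain ⟨c, w, hw⟩ := LB.F_approx il b' hb'
  have h₀ : p μ (S.f il b') = 0 := by
    refine hp' _ _ (fun h' => h ?_) _ (S.f_weight il.1 il.2 ν (Submodule.mem_map_of_mem hν))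
    rw [← h', sub_add_cancel]
  have h₁ := congrArg (p μ) hw
  rw [hF, S.proj_f_pow hp hp', map_sub, h₀, map_smul, hp _ _ hμ, zero_sub] at h₁
  have h₂ : b ∈ LinearMap.range (S.f il ^ (S.d il b' + 2)) := by
    rw [← Submodule.smul_mem_iff _ c.ne_zero, ← neg_mem_iff, ← h₁]
    exact ⟨_, rfl⟩
  rw [S.mem_range_pow_iff il (LB.ne_zero hb)] at h₂
  omega

lemma iterate_E_mem (LB : LowerPerfectBasis S B) {E : I × ℕ+ → V → V}
    (hEdef : ∀ il : I × ℕ+, ∀ b ∈ B, ∀ b' ∈ B, LB.F il b' = b → E il b = b')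
    (il : I × ℕ+) (n : ℕ) : ∀ {b : V} {μ : P}, b ∈ B → b ∈ S.weight μ → S.d il b = n →
      (E il)^[n] b ∈ B ∧ (E il)^[n] b ∈ S.weight (μ + (n * (il.2 : ℕ)) • S.alpha il.1) := by
  induction n with
  | zero => intro b μ hb hμ _; simpa using ⟨hb, hμ⟩
  | succ n ih =>
    intro b μ hb hμ hn
    obtain ⟨b', hb', hF, hd⟩ := LB.exists_F_eq il hb hn
    have := ih hb' (LB.weight_of_F_eq il hb hb' hF (by omega) hμ) hd
    rw [Function.iterate_succ_apply, hEdef il b hb b' hb' hF, add_mul, one_mul, add_smul,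
      add_comm (_ • _), ← add_assoc]
    exact this

/-- The weight of `b_m` lies above that of `b`, at height at least `d_0 + ⋯ + d_{m-1}`. -/
lemma bseq_mem (LB : LowerPerfectBasis S B) {E : I × ℕ+ → V → V}
    (hEdef : ∀ il : I × ℕ+, ∀ b ∈ B, ∀ b' ∈ B, LB.F il b' = b → E il b = b')
    (seq : ℕ → I × ℕ+) {b : V} {μ : P} (hb : b ∈ B) (hμ : b ∈ S.weight μ) (m : ℕ) :
    bseq E S.d seq b m ∈ B ∧ ∃ c : I →₀ ℕ,
      bseq E S.d seq b m ∈ S.weight (μ + Finsupp.linearCombination ℕ S.alpha c) ∧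
      ∑ j ∈ Finset.range m, S.d (seq j) (bseq E S.d seq b j) ≤ c.degree := by
  induction m with
  | zero => exact ⟨hb, 0, by simpa [bseq] using hμ, by simp⟩
  | succ m ih =>
    obtain ⟨hB, c, hc, hle⟩ := ih
    obtain ⟨h₁, h₂⟩ := LB.iterate_E_mem hEdef (seq m) _ hB hc rfl
    refine ⟨h₁, c + Finsupp.single (seq m).1
      (S.d (seq m) (bseq E S.d seq b m) * ((seq m).2 : ℕ)), ?_, ?_⟩
    · rw [map_add, Finsupp.linearCombination_single, ← add_assoc]
      exact h₂
    · rw [Finset.sum_range_succ, map_add, Finsupp.degree_single]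
      exact add_le_add hle (Nat.le_mul_of_pos_right _ (seq m).2.pos)

end LowerPerfectBasis

/-- A sequence of natural numbers with bounded partial sums vanishes eventually. -/
lemma eventually_eq_zero_of_sum_range_le {u : ℕ → ℕ} {N : ℕ}
    (h : ∀ m, ∑ j ∈ Finset.range m, u j ≤ N) : ∃ M, ∀ m ≥ M, u m = 0 := by
  have hs : Summable fun m => (u m : ℝ) :=
    summable_of_sum_range_le (c := (N : ℝ)) (fun m => Nat.cast_nonneg _)
      fun m => by exact_mod_cast h m
  obtain ⟨M, hM⟩ := Filter.eventually_atTop.1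
    (hs.tendsto_atTop_zero.eventually_lt_const zero_lt_one)
  exact ⟨M, fun m hm => Nat.lt_one_iff.1 (by exact_mod_cast hM m hm)⟩

theorem stmt_6 {k I P V : Type*} [Field k] [AddCommGroup P] [AddCommGroup V] [Module k V]
    (S : WeakLowerPerfectSpace k I P V) (B : Set V) (LB : LowerPerfectBasis S B)
(E : I × ℕ+ → V → V)
    (hE0 : ∀ il : I × ℕ+, E il 0 = 0)
    (hEdef : ∀ il : I × ℕ+, ∀ b ∈ B, ∀ b' ∈ B, LB.F il b' = b → E il b = b')
    (hEnone : ∀ il : I × ℕ+, ∀ b ∈ B, (∀ b' ∈ B, LB.F il b' ≠ b) → E il b = 0)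
    (seq : ℕ → I × ℕ+) (hseq : ∀ p : I × ℕ+, ∀ N : ℕ, ∃ m ≥ N, seq m = p)
    (b : V) (hb : b ∈ B) :
    (∃ N : ℕ, ∀ m ≥ N, S.d (seq m) (bseq E S.d seq b m) = 0) ∧
    (∃ N : ℕ, ∀ m ≥ N, bseq E S.d seq b m ∈ S.highestCore B) := by
  obtain ⟨μ, hμ⟩ := LB.graded b hb
  have hmem := LB.bseq_mem hEdef seq hb hμ
  obtain ⟨N, hN⟩ := S.exists_degree_bound μ
  have hd : ∃ M : ℕ, ∀ m ≥ M, S.d (seq m) (bseq E S.d seq b m) = 0 := by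
    refine eventually_eq_zero_of_sum_range_le (N := N) fun m => ?_
    obtain ⟨hB, c, hc, hle⟩ := hmem m
    refine hle.trans (hN c fun hbot => LB.ne_zero hB ?_)
    rwa [hbot, Submodule.mem_bot] at hc
  refine ⟨hd, ?_⟩
  obtain ⟨M, hM⟩ := hd
  have hconst : ∀ m ≥ M, bseq E S.d seq b m = bseq E S.d seq b M := by
    intro m hm
    induction m, hm using Nat.le_induction with
    | base => rfl
    | succ m hm ih => rw [← ih, bseq, hM m hm, Function.iterate_zero_apply]
  refine ⟨M, fun m hm => ⟨(hmem m).1, fun il => ?_⟩⟩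
  obtain ⟨r, hr, rfl⟩ := hseq il M
  rw [hconst m hm, ← hconst r hr]
  exact hM r hr
end
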